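/- arXiv:0806.3668 — 2 statements merged into one kernel-verified Lean document; each statement's English description precedes it below -/
import Mathlib

section
/- Let k ≥ 1 be an integer, and let C be a cycle cover with k objectives in which every cycle has at least k+1 edges. Then there exists a collection of paths P ⊆ C with w(P) ≥ w(C)/2 componentwise. -/
/-- If a finite set has more elements than there are objectives, then some element carries at most
half of the total nonnegative weight in every objective. -/
lemma Finset.exists_mem_forall_le_half_sum {α ι : Type*} [Fintype ι] (S : Finset α)
    (hS : Fintype.card ι < S.card) (w : α → ι → ℝ) (hw : ∀ e i, 0 ≤ w e i) :
    ∃ e ∈ S, ∀ i, w e i ≤ (∑ x ∈ S, w x i) / 2 := by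
  classical
  by_contra! h
  obtain ⟨c, hc⟩ : S.Nonempty := Finset.card_pos.mp (by lia)
  have : Nonempty ι := (h c hc).nonempty
  choose! f hf using h
  obtain ⟨a, ha, b, hb, hab, hfab⟩ :=
    Finset.exists_ne_map_eq_of_card_lt_of_maps_to (s := S) (t := Finset.univ) (f := f)
      (by simpa using hS) (fun _ _ => by simp)
  have hpair : ∑ x ∈ {a, b}, w x (f a) ≤ ∑ x ∈ S, w x (f a) :=
    Finset.sum_le_sum_of_subset_of_nonneg (by simp [Finset.insert_subset_iff, ha, hb])
      (fun x _ _ => hw x _)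
  rw [Finset.sum_pair hab] at hpair
  have h₁ := hf a ha
  have h₂ := hf b hb
  rw [← hfab] at h₂
  linarith

/-- Lemma: for k ≥ 1, every cycle cover with k objectives in which every cycle
has at least k+1 edges possesses a collection of paths of weight at least half
the total weight, componentwise. -/
theorem long_cycles_half_decomposition
    (k : ℕ) (hk : 1 ≤ k) {α : Type*} [DecidableEq α]
    (m : ℕ) (E : Fin m → Finset α)
    (hdisj : ∀ i j, i ≠ j → Disjoint (E i) (E j))
    (hcard : ∀ j, k + 1 ≤ (E j).card)
    (w : α → Fin k → ℝ) (hw : ∀ e i, 0 ≤ w e i) :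
    ∃ P : Fin m → Finset α,
      (∀ j, P j ⊆ E j ∧ P j ≠ E j) ∧
      ∀ i, (∑ j, ∑ e ∈ E j, w e i) / 2 ≤ ∑ j, ∑ e ∈ P j, w e i := by
  have light_edge (j : Fin m) : ∃ e ∈ E j, ∀ i, w e i ≤ (∑ x ∈ E j, w x i) / 2 :=
    (E j).exists_mem_forall_le_half_sum (by simpa using hcard j) w hw
  choose r hr hle using light_edge
  refine ⟨fun j => (E j).erase (r j),
    fun j => ⟨Finset.erase_subset _ _, (Finset.erase_ssubset (hr j)).ne⟩, fun i => ?_⟩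
  rw [Finset.sum_div]
  refine Finset.sum_le_sum fun j _ => ?_
  have hsum := Finset.add_sum_erase (E j) (fun e => w e i) (hr j)
  have hhalf := hle j i
  linarith
end

section
/- Let k ≥ 3 be an odd integer, let δ ∈ [0,1), and let b_1, …, b_m ∈ [0,1] be reals with ∑_{j=1}^m b_j = k+1−2δ. Let z = (k+1)/2 and let C_1, …, C_z ⊆ {1,…,m} be pairwise disjoint sets with 1−δ ≤ w(C_ℓ) < 2−δ for every ℓ, where w(S) = ∑_{j ∈ S} b_j. Define I ∼ J if and only if J can be obtained from I by taking successive symmetric differences with some of the sets C_1, …, C_z, and write [I] for the equivalence class of I. Then for every I ⊆ {1,…,m}, at most two sets J in [I] ∪ [{1,…,m} \ I] satisfy w(J) < 1−δ. -/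
open Finset in
theorem Finset.sum_symmDiff_le {ι : Type*} [DecidableEq ι] {b : ι → ℝ} (hb : ∀ j, 0 ≤ b j)
    (J K : Finset ι) : ∑ j ∈ symmDiff J K, b j ≤ ∑ j ∈ J, b j + ∑ j ∈ K, b j := by
  rw [← sum_union_inter]
  have h : ∑ j ∈ symmDiff J K, b j ≤ ∑ j ∈ J ∪ K, b j :=
    sum_le_sum_of_subset_of_nonneg symmDiff_subset_union fun j _ _ => hb j
  have h' : 0 ≤ ∑ j ∈ J ∩ K, b j := sum_nonneg fun j _ => hb j
  linarith

theorem Finset.symmDiff_biUnion_of_disjoint {ι κ : Type*} [DecidableEq ι] [DecidableEq κ]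
    {C : κ → Finset ι} (hC : ∀ i j, i ≠ j → Disjoint (C i) (C j)) (S T : Finset κ) :
    symmDiff (S.biUnion C) (T.biUnion C) = (symmDiff S T).biUnion C := by
  have key : ∀ i j a, a ∈ C i → a ∈ C j → i = j := fun i j a hi hj => by
    by_contra h
    exact Finset.disjoint_left.mp (hC i j h) hi hj
  ext a
  simp only [Finset.mem_symmDiff, Finset.mem_biUnion]
  constructor
  · rintro (⟨⟨i, hi, ha⟩, h⟩ | ⟨⟨i, hi, ha⟩, h⟩)
    · exact ⟨i, Or.inl ⟨hi, fun hT => h ⟨i, hT, ha⟩⟩, ha⟩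
    · exact ⟨i, Or.inr ⟨hi, fun hS => h ⟨i, hS, ha⟩⟩, ha⟩
  · rintro ⟨i, ⟨hi, h⟩ | ⟨hi, h⟩, ha⟩
    · exact Or.inl ⟨⟨i, hi, ha⟩, fun ⟨j, hj, hja⟩ => h (key i j a ha hja ▸ hj)⟩
    · exact Or.inr ⟨⟨i, hi, ha⟩, fun ⟨j, hj, hja⟩ => h (key i j a ha hja ▸ hj)⟩

/-- Three finite sets at pairwise Hamming distance at most one are not pairwise distinct. -/
theorem Finset.eq_or_eq_or_eq_of_card_symmDiff_le_one {κ : Type*} [DecidableEq κ]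
    {R S T : Finset κ} (hRS : (symmDiff R S).card ≤ 1) (hRT : (symmDiff R T).card ≤ 1)
    (hST : (symmDiff S T).card ≤ 1) : R = S ∨ R = T ∨ S = T := by
  by_contra! h
  obtain ⟨h₁, h₂, h₃⟩ := h
  have pos : ∀ {A B : Finset κ}, A ≠ B → (symmDiff A B).card ≤ 1 →
      ∃ a, symmDiff A B = {a} := fun {A B} hne hle => by
    refine Finset.card_eq_one.mp (le_antisymm hle (Finset.card_pos.mpr ?_))
    rw [Finset.nonempty_iff_ne_empty]
    exact fun h => hne (symmDiff_eq_bot.mp h)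
  obtain ⟨x, hx⟩ := pos h₁ hRS
  obtain ⟨y, hy⟩ := pos h₂ hRT
  have hxy : symmDiff S T = symmDiff {x} {y} := by
    rw [← hx, ← hy, symmDiff_comm R S, symmDiff_assoc, symmDiff_symmDiff_cancel_left]
  by_cases e : x = y
  · subst e
    rw [symmDiff_self] at hxy
    exact h₃ (symmDiff_eq_bot.mp hxy)
  · have hd : Disjoint ({x} : Finset κ) {y} := Finset.disjoint_singleton.mpr e
    rw [hxy, hd.symmDiff_eq_sup, Finset.sup_eq_union, Finset.card_union_of_disjoint hd] at hST
    simp at hST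


/-- For odd k ≥ 3 with z = (k+1)/2 and pairwise disjoint C_1,…,C_z of weight in
[1−δ, 2−δ): for every I, at most two sets J in [I] ∪ [complement of I] satisfy
w(J) < 1−δ, where classes are taken under symmetric differences with the C_ℓ. -/
theorem at_most_two_light_sets_in_class_union_complement_class
    (k : ℕ) (hk : 3 ≤ k) (hodd : Odd k)
    (δ : ℝ) (hδ : δ ∈ Set.Ico (0 : ℝ) 1)
    (m : ℕ) (b : Fin m → ℝ) (hb : ∀ j, b j ∈ Set.Icc (0 : ℝ) 1)
    (hsum : ∑ j, b j = (k : ℝ) + 1 - 2 * δ)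
    (z : ℕ) (hz : 2 * z = k + 1)
    (C : Fin z → Finset (Fin m))
    (hdisj : ∀ i j, i ≠ j → Disjoint (C i) (C j))
    (hC : ∀ ℓ, 1 - δ ≤ ∑ j ∈ C ℓ, b j ∧ ∑ j ∈ C ℓ, b j < 2 - δ)
    (I : Finset (Fin m)) :
    {J : Finset (Fin m) |
        ((∃ T : Finset (Fin z), J = symmDiff I (T.biUnion C)) ∨
         (∃ T : Finset (Fin z), J = symmDiff Iᶜ (T.biUnion C))) ∧
        ∑ j ∈ J, b j < 1 - δ}.ncard ≤ 2 := by
  obtain ⟨hδ0, hδ1⟩ := hδ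
  have hb0 : ∀ j, 0 ≤ b j := fun j => (hb j).1
  have hpd (T : Finset (Fin z)) : (T : Set (Fin z)).PairwiseDisjoint C :=
    fun i _ j _ hij => hdisj i j hij
  have hzk : (k : ℝ) + 1 = 2 * z := by exact_mod_cast hz.symm
  have card_le_one {T : Finset (Fin z)} (h : ∑ j ∈ T.biUnion C, b j < 2 - 2 * δ) :
      T.card ≤ 1 := by
    rw [Finset.sum_biUnion (hpd T)] at h
    have hT := Finset.card_nsmul_le_sum T _ _ fun ℓ _ => (hC ℓ).1
    rw [nsmul_eq_mul] at hT
    by_contra! hlt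
    have h2 : (2 : ℝ) ≤ T.card := by exact_mod_cast hlt
    nlinarith
  have eq_univ {T : Finset (Fin z)} (h : ∑ j ∈ (T.biUnion C)ᶜ, b j < 2 - 2 * δ) :
      T = Finset.univ := by
    have hcompl := Finset.sum_add_sum_compl (T.biUnion C) b
    rw [Finset.sum_biUnion (hpd T), hsum] at hcompl
    have hT := Finset.sum_le_card_nsmul T _ _ fun ℓ _ => (hC ℓ).2.le
    rw [nsmul_eq_mul] at hT
    by_contra hne
    have hlt : T.card < z := by
      simpa using Finset.card_lt_card (Finset.ssubset_univ_iff.mpr hne)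
    have h1 : (T.card : ℝ) + 1 ≤ z := by exact_mod_cast hlt
    have h2 : 0 ≤ (T.card : ℝ) * δ := by positivity
    nlinarith
  have near {A S T : Finset _} (hS : ∑ j ∈ symmDiff A (S.biUnion C), b j < 1 - δ)
      (hT : ∑ j ∈ symmDiff A (T.biUnion C), b j < 1 - δ) : (symmDiff S T).card ≤ 1 := by
    apply card_le_one
    have h := Finset.sum_symmDiff_le hb0 (symmDiff A (S.biUnion C)) (symmDiff A (T.biUnion C))
    rw [symmDiff_comm A (S.biUnion C), symmDiff_assoc, symmDiff_symmDiff_cancel_left,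
      Finset.symmDiff_biUnion_of_disjoint hdisj, symmDiff_comm (S.biUnion C)] at h
    linarith
  have far {S T : Finset _} (hS : ∑ j ∈ symmDiff I (S.biUnion C), b j < 1 - δ)
      (hT : ∑ j ∈ symmDiff Iᶜ (T.biUnion C), b j < 1 - δ) : symmDiff S T = Finset.univ := by
    apply eq_univ
    have h := Finset.sum_symmDiff_le hb0 (symmDiff I (S.biUnion C)) (symmDiff Iᶜ (T.biUnion C))
    have e : symmDiff (symmDiff I (S.biUnion C)) (symmDiff Iᶜ (T.biUnion C)) =
        ((symmDiff S T).biUnion C)ᶜ := by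
      rw [← Finset.symmDiff_biUnion_of_disjoint hdisj]
      ext a
      simp only [Finset.mem_symmDiff, Finset.mem_compl]
      tauto
    rw [e] at h
    linarith
  have cancel_right {R S T : Finset (Fin z)} (hR : symmDiff R T = Finset.univ)
      (hS : symmDiff S T = Finset.univ) : R = S :=
    symmDiff_left_injective T (hR.trans hS.symm)
  have cancel_left {R S T : Finset (Fin z)} (hR : symmDiff T R = Finset.univ)
      (hS : symmDiff T S = Finset.univ) : R = S :=
    symmDiff_right_injective T (hR.trans hS.symm)
  by_contra! hcard
  obtain ⟨J₁, J₂, J₃, ⟨h₁, l₁⟩, ⟨h₂, l₂⟩, ⟨h₃, l₃⟩, n₁₂, n₁₃, n₂₃⟩ :=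
    (Set.two_lt_ncard_iff (Set.toFinite _)).mp hcard
  rcases h₁ with ⟨T₁, rfl⟩ | ⟨T₁, rfl⟩ <;> rcases h₂ with ⟨T₂, rfl⟩ | ⟨T₂, rfl⟩ <;>
    rcases h₃ with ⟨T₃, rfl⟩ | ⟨T₃, rfl⟩
  · rcases Finset.eq_or_eq_or_eq_of_card_symmDiff_le_one (near l₁ l₂) (near l₁ l₃) (near l₂ l₃)
      with rfl | rfl | rfl <;> contradiction
  · exact n₁₂ (by rw [cancel_right (far l₁ l₃) (far l₂ l₃)])
  · exact n₁₃ (by rw [cancel_right (far l₁ l₂) (far l₃ l₂)])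
  · exact n₂₃ (by rw [cancel_left (far l₁ l₂) (far l₁ l₃)])
  · exact n₂₃ (by rw [cancel_right (far l₂ l₁) (far l₃ l₁)])
  · exact n₁₃ (by rw [cancel_left (far l₂ l₁) (far l₂ l₃)])
  · exact n₁₂ (by rw [cancel_left (far l₃ l₁) (far l₃ l₂)])
  · rcases Finset.eq_or_eq_or_eq_of_card_symmDiff_le_one (near l₁ l₂) (near l₁ l₃) (near l₂ l₃)
      with rfl | rfl | rfl <;> contradiction
end
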